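/- arXiv:1604.06137 — 2 statements merged into one kernel-verified Lean document; each statement's English description precedes it below -/
import Mathlib

section
/- Let P and Q be two distinct points of PG(2,q²) with P ∉ U and Q ∉ U. Then τ_P(U) ∩ τ_Q(U) is nonempty if and only if the line through P and Q is tangent to U (i.e. contains exactly one point of U); in that case τ_P(U) ∩ τ_Q(U) consists exactly of that unique point of U on the line through P and Q. -/
noncomputable section
open Projectivization
open scoped LinearAlgebra.Projectivization

/-- `Pt K` is the point set of `PG(2, q²)`, i.e. the projectivization of `K³`. -/
abbrev Pt (K : Type) [Field K] : Type := ℙ K (Fin 3 → K)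

lemma vec1_ne_zero {K : Type} [Field K] (a b : K) : ![a, b, (1 : K)] ≠ 0 := by
  intro h
  have := congrFun h 2
  simp at this

lemma vecInf_ne_zero {K : Type} [Field K] : ![(0 : K), 1, 0] ≠ 0 := by
  intro h
  have := congrFun h 1
  simp at this

lemma vec100_ne_zero {K : Type} [Field K] : ![(1 : K), 0, 0] ≠ 0 := by
  intro h
  have := congrFun h 0
  simp at this

/-- The orthogonal-Buekenhout-Metz unital
`U = {[x, αx² + βN(x) + r, 1] : x ∈ K, r ∈ GF(q)} ∪ {[0,1,0]}`,
where `GF(q) = {r : r^q = r}` and `N(x) = x^(q+1)`. -/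
def unital (K : Type) [Field K] (q : ℕ) (α β : K) : Set (Pt K) :=
  {P | (∃ x r : K, r ^ q = r ∧
      P = Projectivization.mk K ![x, α * x ^ 2 + β * x ^ (q + 1) + r, 1] (vec1_ne_zero _ _)) ∨
    P = Projectivization.mk K ![0, 1, 0] vecInf_ne_zero}

/-- The line through two points `A`, `B`: all points `[w]` with `w ∈ span{u, v}` where
`A = [u]`, `B = [v]`. -/
def lineThrough {K : Type} [Field K] (A B : Pt K) : Set (Pt K) :=
  {C | C.submodule ≤ A.submodule ⊔ B.submodule}

/-- The pedal `τ_P(U)` of `P`: the set of feet of `P`, i.e. points `A ∈ U` such that `A`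
is the only point of `U` on the line through `P` and `A`. -/
def pedal {K : Type} [Field K] (U : Set (Pt K)) (P : Pt K) : Set (Pt K) :=
  {A | A ∈ U ∧ lineThrough P A ∩ U = {A}}

section Projective

variable {K : Type} [Field K]

lemma finrank_sup_submodule {A B : Pt K} (hAB : A ≠ B) :
    Module.finrank K ↥(A.submodule ⊔ B.submodule) = 2 := by
  refine le_antisymm ?_ ?_
  · have := Submodule.finrank_add_le_finrank_add_finrank A.submodule B.submodule
    simpa [Projectivization.finrank_submodule] using this
  · have hlt : A.submodule < A.submodule ⊔ B.submodule := by
      refine lt_of_le_of_ne le_sup_left fun h => hAB ?_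
      have hBA : B.submodule ≤ A.submodule := h ▸ le_sup_right
      refine (Projectivization.submodule_injective
        (Submodule.eq_of_le_of_finrank_eq hBA ?_)).symm
      rw [Projectivization.finrank_submodule, Projectivization.finrank_submodule]
    have := Submodule.finrank_lt_finrank_of_lt hlt
    rw [Projectivization.finrank_submodule] at this
    omega

lemma sup_submodule_eq_of_le {A B : Pt K} (hAB : A ≠ B) {W : Submodule K (Fin 3 → K)}
    (hW : Module.finrank K W = 2) (hA : A.submodule ≤ W) (hB : B.submodule ≤ W) :
    A.submodule ⊔ B.submodule = W :=
  Submodule.eq_of_le_of_finrank_eq (sup_le hA hB) ((finrank_sup_submodule hAB).trans hW.symm)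

lemma finrank_ker_eq_two {l : (Fin 3 → K) →ₗ[K] K} (hl : l ≠ 0) :
    Module.finrank K (LinearMap.ker l) = 2 := by
  have h := l.finrank_range_add_finrank_ker
  rw [LinearMap.range_eq_top.2 (LinearMap.surjective hl)] at h
  simp only [finrank_top, Module.finrank_self, Module.finrank_fin_fun] at h
  omega

lemma mk_mem_lineThrough {a b c : Fin 3 → K} (ha : a ≠ 0) (hb : b ≠ 0) (hc : c ≠ 0)
    (s t : K) (h : c = s • a + t • b) :
    Projectivization.mk K c hc ∈
      lineThrough (Projectivization.mk K a ha) (Projectivization.mk K b hb) := by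
  simp only [lineThrough, Set.mem_ofPred_eq, Projectivization.submodule_mk]
  rw [Submodule.span_singleton_le_iff_mem, h]
  exact add_mem
    (Submodule.smul_mem _ _ (Submodule.mem_sup_left (Submodule.mem_span_singleton_self a)))
    (Submodule.smul_mem _ _ (Submodule.mem_sup_right (Submodule.mem_span_singleton_self b)))

end Projective

section Unital

variable {K : Type} [Field K]

/-- The quadratic form `w ↦ αw² - conj + (β - β̄)N(w)` is anisotropic. -/
lemma quadratic_ne_zero (σ : K →+* K) (hσ : ∀ x, σ (σ x) = x) {α β : K}
    (hns : ¬ ∃ s : K, σ s = s ∧ 4 * (α * σ α) + (σ β - β) ^ 2 = s ^ 2) {w : K} (hw : w ≠ 0) :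
    α * w ^ 2 - σ α * σ w ^ 2 + (β - σ β) * (w * σ w) ≠ 0 := by
  intro h
  have hw' : σ w ≠ 0 := (map_ne_zero σ).2 hw
  refine hns ⟨2 * α * (w / σ w) + (β - σ β), ?_, ?_⟩
  · simp only [map_add, map_mul, map_div₀, map_sub, hσ, map_ofNat]
    field_simp
    linear_combination (-2) * h
  · field_simp
    linear_combination (-4 * α) * h

/-- A line through an affine point of the unital, in a direction whose linear term `c` does not
vanish, meets the unital again. -/
lemma exists_second_root (σ : K →+* K) (hσ : ∀ x, σ (σ x) = x) {α β : K}
    (hns : ¬ ∃ s : K, σ s = s ∧ 4 * (α * σ α) + (σ β - β) ^ 2 = s ^ 2)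
    {ε : K} (hε : σ ε ≠ ε) {c : K} (hc : c ≠ 0) :
    ∃ t : K, t ≠ 0 ∧
      c * t - σ c * σ t - (α * t ^ 2 - σ α * σ t ^ 2) - (β - σ β) * (t * σ t) = 0 := by
  have hε0 : ε ≠ 0 := by rintro rfl; simp at hε
  have hw : ε / c ≠ 0 := div_ne_zero hε0 hc
  have hD := quadratic_ne_zero σ hσ hns hw
  obtain ⟨w, hwdef⟩ : ∃ w, w = ε / c := ⟨_, rfl⟩
  rw [← hwdef] at hw hD
  have hcw : c * w = ε := by rw [hwdef]; field_simp
  set D := α * w ^ 2 - σ α * σ w ^ 2 + (β - σ β) * (w * σ w) with hDdef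
  have hσD : σ D = -D := by
    simp only [hDdef, map_add, map_sub, map_mul, map_pow, hσ]; ring
  have hσs : σ ((ε - σ ε) / D) = (ε - σ ε) / D := by
    rw [map_div₀, hσD, map_sub, hσ, ← neg_sub, neg_div_neg_eq]
  have hs : (ε - σ ε) / D * D = ε - σ ε := div_mul_cancel₀ _ hD
  have hs0 : (ε - σ ε) / D ≠ 0 := div_ne_zero (sub_ne_zero.2 hε.symm) hD
  generalize (ε - σ ε) / D = s at *
  refine ⟨s * w, mul_ne_zero hs0 hw, ?_⟩
  have hcw' : σ c * σ w = σ ε := by rw [← map_mul, hcw]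
  rw [map_mul, hσs]
  rw [hDdef] at hs
  linear_combination s * hcw - s * hcw' - s * hs

/-- All tangent lines at a point of the unital lie in a common plane of `K³`. -/
lemma exists_tangent_plane (q : ℕ) (σ : K →+* K) (hσq : ∀ x, σ x = x ^ q)
    (hσ : ∀ x, σ (σ x) = x) {α β : K}
    (hns : ¬ ∃ s : K, σ s = s ∧ 4 * (α * σ α) + (σ β - β) ^ 2 = s ^ 2)
    {ε : K} (hε : σ ε ≠ ε) {A : Pt K} (hA : A ∈ unital K q α β) :
    ∃ W : Submodule K (Fin 3 → K), Module.finrank K W = 2 ∧ A.submodule ≤ W ∧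
      ∀ P : Pt K, P ≠ A → lineThrough P A ∩ unital K q α β = {A} → P.submodule ≤ W := by
  have hq0 : (0 : K) ^ q = 0 := by rw [← hσq, map_zero]
  have hN : ∀ x : K, x ^ (q + 1) = σ x * x := fun x => by rw [hσq, pow_succ]
  rcases hA with ⟨x, r, hr, rfl⟩ | rfl
  · obtain ⟨y, hy⟩ : ∃ y, y = α * x ^ 2 + β * x ^ (q + 1) + r := ⟨_, rfl⟩
    obtain ⟨m, hm⟩ : ∃ m, m = 2 * α * x + (β - σ β) * σ x := ⟨_, rfl⟩
    simp only [← hy]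
    let l : (Fin 3 → K) →ₗ[K] K := LinearMap.proj 1 - y • LinearMap.proj 2
      - m • (LinearMap.proj 0 - x • LinearMap.proj 2)
    have hl : ∀ v, l v = v 1 - y * v 2 - m * (v 0 - x * v 2) := fun v => by simp [l]
    refine ⟨LinearMap.ker l, finrank_ker_eq_two fun h => ?_, ?_, ?_⟩
    · simpa [hl] using congrArg (fun g => g ![0, 1, 0]) h
    · rw [Projectivization.submodule_mk, Submodule.span_singleton_le_iff_mem, LinearMap.mem_ker,
        hl]
      simp
    · intro P
      induction P using Projectivization.ind with
      | h v hv =>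
      intro hPA htan
      rw [Projectivization.submodule_mk, Submodule.span_singleton_le_iff_mem, LinearMap.mem_ker,
        hl]
      obtain ⟨e, he⟩ : ∃ e, e = v 0 - x * v 2 := ⟨_, rfl⟩
      obtain ⟨f, hf⟩ : ∃ f, f = v 1 - y * v 2 := ⟨_, rfl⟩
      rw [← he, ← hf]
      by_contra hne
      have key : ∀ C ∈ unital K q α β, C ∈ lineThrough (Projectivization.mk K v hv)
          (Projectivization.mk K ![x, y, 1] (vec1_ne_zero _ _)) →
          C = Projectivization.mk K ![x, y, 1] (vec1_ne_zero _ _) := by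
        intro C h1 h2
        exact htan.subset ⟨h2, h1⟩
      by_cases he0 : e = 0
      · have hf0 : f ≠ 0 := by rintro rfl; simp [he0] at hne
        have := key _ (Or.inr rfl) (mk_mem_lineThrough _ _ _ f⁻¹ (-(f⁻¹ * v 2)) ?_)
        · rw [Projectivization.mk_eq_mk_iff'] at this
          obtain ⟨a, ha⟩ := this
          have h0 := congrFun ha 2
          have h1 := congrFun ha 1
          simp at h0 h1
          simp [h0] at h1
        · ext i
          fin_cases i
          · simp only [Fin.zero_eta, Pi.add_apply, Pi.smul_apply, smul_eq_mul,
              Matrix.cons_val_zero]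
            linear_combination f⁻¹ * he - f⁻¹ * he0
          · have := inv_mul_cancel₀ hf0
            simp only [Fin.mk_one, Pi.add_apply, Pi.smul_apply, smul_eq_mul,
              Matrix.cons_val_one, Matrix.cons_val_zero]
            linear_combination f⁻¹ * hf - this
          · simp
      · have hc : f / e - m ≠ 0 := by
          intro h
          apply hne
          field_simp at h
          linear_combination h
        obtain ⟨t, ht, hroot⟩ := exists_second_root σ hσ hns hε hc
        obtain ⟨g, hg⟩ : ∃ g, g = f / e := ⟨_, rfl⟩
        rw [← hg] at hroot
        have hge : g * e = f := by rw [hg]; field_simp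
        have hU : Projectivization.mk K ![x + t, y + g * t, 1] (vec1_ne_zero _ _) ∈
            unital K q α β := by
          refine Or.inl ⟨x + t, y + g * t - (α * (x + t) ^ 2 + β * (x + t) ^ (q + 1)), ?_, ?_⟩
          · rw [← hσq] at hr
            rw [hN] at hy
            rw [hN, ← hσq, hy]
            simp only [map_add, map_sub, map_mul, map_pow, hσ, hr]
            rw [hm] at hroot
            simp only [map_add, map_sub, map_mul, hσ, map_ofNat] at hroot
            linear_combination -hroot
          · congr 1
            simp
        have := key _ hU (mk_mem_lineThrough _ _ _ (t / e) (1 - t / e * v 2) ?_)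
        · rw [Projectivization.mk_eq_mk_iff'] at this
          obtain ⟨a, ha⟩ := this
          have h0 := congrFun ha 2
          have h1 := congrFun ha 0
          simp at h0 h1
          exact ht (by rw [h0] at h1; linear_combination -h1)
        · have hte : t / e * e = t := by field_simp
          ext i
          fin_cases i
          · simp only [Fin.zero_eta, Pi.add_apply, Pi.smul_apply, smul_eq_mul,
              Matrix.cons_val_zero]
            linear_combination t / e * he - hte
          · simp only [Fin.mk_one, Pi.add_apply, Pi.smul_apply, smul_eq_mul,
              Matrix.cons_val_one, Matrix.cons_val_zero]
            linear_combination t / e * hf - g * hte + t / e * hge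
          · simp
  · refine ⟨LinearMap.ker (LinearMap.proj 2 : (Fin 3 → K) →ₗ[K] K),
      finrank_ker_eq_two fun h => ?_, ?_, ?_⟩
    · simpa using congrArg (fun g => g ![0, 0, 1]) h
    · rw [Projectivization.submodule_mk, Submodule.span_singleton_le_iff_mem]
      simp
    · intro P
      induction P using Projectivization.ind with
      | h v hv =>
      intro hPA htan
      rw [Projectivization.submodule_mk, Submodule.span_singleton_le_iff_mem, LinearMap.mem_ker]
      change v 2 = 0
      by_contra hd
      obtain ⟨y, hy⟩ : ∃ y, y = α * (v 0 / v 2) ^ 2 + β * (v 0 / v 2) ^ (q + 1) + 0 := ⟨_, rfl⟩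
      have hU : Projectivization.mk K ![v 0 / v 2, y, 1] (vec1_ne_zero _ _) ∈ unital K q α β :=
        Or.inl ⟨v 0 / v 2, 0, hq0, by simp only [hy]⟩
      have hmem := mk_mem_lineThrough hv (vecInf_ne_zero (K := K)) (vec1_ne_zero (v 0 / v 2) y)
        (v 2)⁻¹ (y - (v 2)⁻¹ * v 1) ?_
      · have := htan.subset ⟨hmem, hU⟩
        rw [Set.mem_singleton_iff, Projectivization.mk_eq_mk_iff'] at this
        obtain ⟨a, ha⟩ := this
        simpa using congrFun ha 2
      · ext i
        fin_cases i
        · simp [div_eq_inv_mul]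
        · simp
        · simp [hd]

lemma exists_pow_ne_self [Fintype K] {q : ℕ} (hq : 1 < q) (hcard : Fintype.card K = q ^ 2) :
    ∃ ε : K, ε ^ q ≠ ε := by
  by_contra! h
  have hne := FiniteField.X_pow_card_sub_X_ne_zero K hq
  have hle : Fintype.card K ≤ q := by
    rw [← FiniteField.X_pow_card_sub_X_natDegree_eq K hq]
    refine Polynomial.card_le_degree_of_subset_roots (Z := Finset.univ) fun x _ => ?_
    rw [Polynomial.mem_roots hne]
    simp [h x]
  nlinarith

lemma exists_conj [Fintype K] {p n q : ℕ} (hp : p.Prime) (hq : q = p ^ n)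
    (hcard : Fintype.card K = q ^ 2) :
    ∃ σ : K →+* K, (∀ x, σ x = x ^ q) ∧ ∀ x, σ (σ x) = x := by
  have : Fact p.Prime := ⟨hp⟩
  have : CharP K p := charP_of_card_eq_prime_pow (f := n * 2) (by rw [hcard, hq, pow_mul])
  refine ⟨iterateFrobenius K p n, fun x => by rw [iterateFrobenius_def, hq], fun x => ?_⟩
  rw [iterateFrobenius_def, iterateFrobenius_def, ← hq, ← pow_mul, ← sq, ← hcard,
    FiniteField.pow_card]

end Unital

theorem stmt_2 {K : Type} [Field K] [Fintype K] (p n q : ℕ)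
    (hp : p.Prime) (hpodd : Odd p) (hn : 0 < n) (hq : q = p ^ n)
    (hcard : Fintype.card K = q ^ 2)
    (α β : K) (hα : α ≠ 0)
    (hns : ¬ ∃ s : K, s ^ q = s ∧ 4 * α ^ (q + 1) + (β ^ q - β) ^ 2 = s ^ 2)
    (P Q : Pt K) (hPQ : P ≠ Q)
    (hP : P ∉ unital K q α β) (hQ : Q ∉ unital K q α β) :
    ((pedal (unital K q α β) P ∩ pedal (unital K q α β) Q).Nonempty ↔
      ∃ A : Pt K, lineThrough P Q ∩ unital K q α β = {A}) ∧
    ∀ A : Pt K, lineThrough P Q ∩ unital K q α β = {A} →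
      pedal (unital K q α β) P ∩ pedal (unital K q α β) Q = {A} := by
  obtain ⟨σ, hσq, hσ⟩ := exists_conj hp hq hcard
  have hq1 : 1 < q := hq ▸ Nat.one_lt_pow hn.ne' hp.one_lt
  obtain ⟨ε, hε⟩ := exists_pow_ne_self hq1 hcard
  rw [← hσq] at hε
  have hns' : ¬ ∃ s : K, σ s = s ∧ 4 * (α * σ α) + (σ β - β) ^ 2 = s ^ 2 := by
    rintro ⟨s, h1, h2⟩
    rw [hσq] at h1
    rw [hσq, hσq, ← pow_succ'] at h2
    exact hns ⟨s, h1, h2⟩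
  have hline : ∀ {X Y Z : Pt K}, X.submodule ⊔ Y.submodule = X.submodule ⊔ Z.submodule →
      lineThrough X Y = lineThrough X Z := fun h => by simp only [lineThrough, h]
  have foot : ∀ A ∈ pedal (unital K q α β) P ∩ pedal (unital K q α β) Q,
      lineThrough P Q ∩ unital K q α β = {A} := by
    rintro A ⟨⟨hA, hPA⟩, -, hQA⟩
    obtain ⟨W, hW, hAW, hWt⟩ := exists_tangent_plane q σ hσq hσ hns' hε hA
    have hPA' : P ≠ A := fun h => hP (h ▸ hA)
    have hQA' : Q ≠ A := fun h => hQ (h ▸ hA)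
    have hPW := hWt P hPA' hPA
    rw [← hPA, hline ((sup_submodule_eq_of_le hPQ hW hPW (hWt Q hQA' hQA)).trans
      (sup_submodule_eq_of_le hPA' hW hPW hAW).symm)]
  have tangent : ∀ A : Pt K, lineThrough P Q ∩ unital K q α β = {A} →
      A ∈ pedal (unital K q α β) P ∩ pedal (unital K q α β) Q := by
    intro A h
    obtain ⟨hAl, hA⟩ : A ∈ lineThrough P Q ∩ unital K q α β := h ▸ Set.mem_singleton A
    have hPA' : P ≠ A := fun h => hP (h ▸ hA)
    have hQA' : Q ≠ A := fun h => hQ (h ▸ hA)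
    have hW := finrank_sup_submodule hPQ
    have h1 := sup_submodule_eq_of_le hPA' hW le_sup_left hAl
    have h2 := sup_submodule_eq_of_le hQA' hW le_sup_right hAl
    refine ⟨⟨hA, ?_⟩, hA, ?_⟩
    · rw [hline h1, h]
    · rw [← h]
      simp only [lineThrough, h2]
  refine ⟨⟨fun ⟨A, hA⟩ => ⟨A, foot A hA⟩, fun ⟨A, hA⟩ => ⟨A, tangent A hA⟩⟩, fun A hA => ?_⟩
  refine Set.eq_singleton_iff_unique_mem.2 ⟨tangent A hA, fun B hB => ?_⟩
  exact (Set.singleton_injective ((foot B hB).symm.trans hA))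
end
end

section
/- Let x ∈ T_λ with x ≠ 0, so that Q_x ≠ Q_{−x}, and let l_{x,−x} be the line of PG(2,q²) through Q_x and Q_{−x}. If Q_y ∈ l_{x,−x} for some y ∈ T_λ, then Q_{−y} ∈ l_{x,−x}. -/
noncomputable section
open Projectivization
open scoped LinearAlgebra.Projectivization

/-- The set `T_λ = {x ∈ K : 2e + αx² − ᾱx̄² + (β−β̄)N(x) = 0}` (with `x̄ = x^q`, `N(x) = x^(q+1)`). -/
def Tlam (K : Type) [Field K] (q : ℕ) (α β e : K) : Set K :=
  {x | 2 * e + α * x ^ 2 - α ^ q * (x ^ q) ^ 2 + (β - β ^ q) * x ^ (q + 1) = 0}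

/-- The point `Q_x = [x, T(αx²) − e, 1]`, where `T(y) = y + y^q`. -/
def Qpt (K : Type) [Field K] (q : ℕ) (α e : K) (x : K) : Pt K :=
  Projectivization.mk K ![x, (α * x ^ 2 + (α * x ^ 2) ^ q) - e, 1] (vec1_ne_zero _ _)

lemma mk_mem_lineThrough_iff {K : Type} [Field K] {u v w : Fin 3 → K}
    (hu : u ≠ 0) (hv : v ≠ 0) (hw : w ≠ 0) :
    Projectivization.mk K w hw ∈
      lineThrough (Projectivization.mk K u hu) (Projectivization.mk K v hv) ↔
      ∃ a b : K, a • u + b • v = w := by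
  simp only [lineThrough, Set.mem_ofPred_eq, Projectivization.submodule_mk]
  rw [← Submodule.span_union, Submodule.span_singleton_le_iff_mem, Set.singleton_union,
    Submodule.mem_span_pair]

theorem stmt_8 {K : Type} [Field K] [Fintype K] (p n q : ℕ)
    (hp : p.Prime) (hpodd : Odd p) (hn : 0 < n) (hq : q = p ^ n)
    (hcard : Fintype.card K = q ^ 2)
    (α β : K) (hα : α ≠ 0)
    (hns : ¬ ∃ s : K, s ^ q = s ∧ 4 * α ^ (q + 1) + (β ^ q - β) ^ 2 = s ^ 2)
    (e : K) (he : e ≠ 0) (heq : e ^ q = -e)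
    (x : K) (hx : x ∈ Tlam K q α β e) (hx0 : x ≠ 0)
    (y : K) (hy : y ∈ Tlam K q α β e)
    (hmem : Qpt K q α e y ∈ lineThrough (Qpt K q α e x) (Qpt K q α e (-x))) :
    Qpt K q α e (-y) ∈ lineThrough (Qpt K q α e x) (Qpt K q α e (-x)) := by
  simp only [Qpt, mk_mem_lineThrough_iff] at hmem ⊢
  obtain ⟨a, b, hab⟩ := hmem
  have h0 := congrFun hab 0
  have h1 := congrFun hab 1
  have h2 := congrFun hab 2
  simp at h0 h1 h2
  refine ⟨b, a, ?_⟩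
  ext i
  fin_cases i
  · simp
    linear_combination -h0
  · simp
    linear_combination h1
  · simp
    linear_combination h2
end
end
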